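/- arXiv:2303.01262 — 2 statements merged into one kernel-verified Lean document; each statement's English description precedes it below -/
import Mathlib

section
/- Let D and D' be neighboring datasets (one is obtained from the other by adding or removing a single point), fix a rank r and α ≥ 0, and define the windowed loss ℓ_D(τ) = min over τ' ∈ [τ−α, τ+α] of rankerror(τ', r, D), and similarly ℓ_{D'}. Then for every τ ∈ ℝ, |ℓ_D(τ) − ℓ_{D'}(τ)| ≤ 1; in particular, |rankerror(τ', r, D) − rankerror(τ', r, D')| ≤ 1 for every τ'. -/
open MeasureTheory Multiset

noncomputable section

/-- Add/remove distance between multisets. -/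
def mdist (D D' : Multiset ℝ) : ℕ := (D - D').card + (D' - D).card

/-- Neighboring datasets. -/
def Neighboring (D D' : Multiset ℝ) : Prop := mdist D D' = 1

/-- `A` is an `ε`-differentially private randomized algorithm. -/
def IsDP (A : Multiset ℝ → Measure ℝ) (ε : ℝ) : Prop :=
  (∀ D, IsProbabilityMeasure (A D)) ∧
  ∀ D D' : Multiset ℝ, Neighboring D D' → ∀ S : Set ℝ, MeasurableSet S →
    A D S ≤ ENNReal.ofReal (Real.exp ε) * A D' S

/-- Mean of a dataset. -/
def mmean (D : Multiset ℝ) : ℝ := D.sum / D.card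

/-- The multiset of the `m` smallest elements of `D`. -/
def lowerM (m : ℕ) (D : Multiset ℝ) : Multiset ℝ := ((D.sort (· ≤ ·)).take m : List ℝ)

/-- The multiset of the `m` largest elements of `D`. -/
def upperM (m : ℕ) (D : Multiset ℝ) : Multiset ℝ := ((D.sort (· ≤ ·)).drop (D.card - m) : List ℝ)

/-- Subset-based risk for mean estimation. -/
def meanRisk (D : Multiset ℝ) (ε : ℝ) : ℝ :=
  ⨅ A : {A : Multiset ℝ → Measure ℝ // IsDP A ε},
    ⨆ D' : {D' : Multiset ℝ // D' ≤ D ∧ (D.card : ℝ) - 1/ε ≤ D'.card},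
      ∫ y, |y - mmean D'.1| ∂(A.1 D'.1)
/-- Number of elements of `D` strictly below `τ` (with multiplicity). -/
def countLt (D : Multiset ℝ) (τ : ℝ) : ℕ := (D.filter (fun x => x < τ)).card

/-- Number of elements of `D` at most `τ` (with multiplicity). -/
def countLe (D : Multiset ℝ) (τ : ℝ) : ℕ := (D.filter (fun x => x ≤ τ)).card

/-- `τ` is a rank-`r` threshold for `D`: at most `r` points are strictly below `τ`
and at least `r` points are at most `τ`. -/
def IsRankThreshold (τ : ℝ) (r : ℕ) (D : Multiset ℝ) : Prop :=
  countLt D τ ≤ r ∧ r ≤ countLe D τ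

/-- `ranks τ D` is the set of ranks `r ∈ {0, …, |D|}` for which `τ` is a rank-`r`
threshold for `D`. -/
def ranks (τ : ℝ) (D : Multiset ℝ) : Set ℕ := {r | r ≤ D.card ∧ IsRankThreshold τ r D}

/-- `rankerror τ r D = min_{r' ∈ ranks(τ, D)} |r − r'|`. -/
def rankerror (τ r : ℝ) (D : Multiset ℝ) : ℝ :=
  sInf ((fun r' : ℕ => |r - (r' : ℝ)|) '' ranks τ D)

/-- The windowed loss `ℓ(τ) = min_{τ' ∈ [τ−α, τ+α]} rankerror(τ', r, D)`. -/
def winLoss (α r : ℝ) (D : Multiset ℝ) (τ : ℝ) : ℝ :=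
  sInf ((fun τ' => rankerror τ' r D) '' Set.Icc (τ - α) (τ + α))

/-- `τ` is an `(α, β)`-approximate rank-`r` threshold for `D`. -/
def IsApproxRankThreshold (α β τ r : ℝ) (D : Multiset ℝ) : Prop :=
  ∃ τ', |τ - τ'| ≤ α ∧ rankerror τ' r D ≤ β

/-- The continuous exponential mechanism on `[a, b]` with privacy parameter `ε` and
loss function `loss`: the distribution with density proportional to
`exp(−(ε/2) loss τ)` on `[a, b]`. -/
def expMech (a b ε : ℝ) (loss : ℝ → ℝ) : Measure ℝ :=
  (volume.restrict (Set.Icc a b)).withDensity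
    (fun τ => ENNReal.ofReal (Real.exp (-(ε/2) * loss τ) /
      ∫ τ' in Set.Icc a b, Real.exp (-(ε/2) * loss τ')))
lemma sInf_image_le_sInf_image_add_one {ι κ : Type*} {S : Set ι} {T : Set κ} {f : ι → ℝ}
    {g : κ → ℝ} (hf : ∀ s ∈ S, 0 ≤ f s) (hT : T.Nonempty)
    (h : ∀ t ∈ T, ∃ s ∈ S, f s ≤ g t + 1) :
    sInf (f '' S) ≤ sInf (g '' T) + 1 := by
  rw [← sub_le_iff_le_add]
  refine le_csInf (hT.image g) ?_
  rintro _ ⟨t, ht, rfl⟩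
  obtain ⟨s, hs, hst⟩ := h t ht
  have hbdd : BddBelow (f '' S) := ⟨0, by rintro _ ⟨u, hu, rfl⟩; exact hf u hu⟩
  linarith [csInf_le hbdd (Set.mem_image_of_mem f hs)]

lemma countLt_le_countLe (D : Multiset ℝ) (τ : ℝ) : countLt D τ ≤ countLe D τ :=
  Multiset.card_le_card (Multiset.monotone_filter_right D fun _ h => le_of_lt h)

lemma mem_ranks_iff {τ : ℝ} {D : Multiset ℝ} {n : ℕ} :
    n ∈ ranks τ D ↔ countLt D τ ≤ n ∧ n ≤ countLe D τ :=
  ⟨fun h => h.2, fun h => ⟨h.2.trans (Multiset.card_le_card (Multiset.filter_le _ D)), h⟩⟩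

lemma ranks_nonempty (τ : ℝ) (D : Multiset ℝ) : (ranks τ D).Nonempty :=
  ⟨countLt D τ, mem_ranks_iff.2 ⟨le_rfl, countLt_le_countLe D τ⟩⟩

lemma rankerror_nonneg (τ r : ℝ) (D : Multiset ℝ) : 0 ≤ rankerror τ r D :=
  Real.sInf_nonneg (by rintro _ ⟨n, -, rfl⟩; exact abs_nonneg _)

lemma Neighboring.symm {D D' : Multiset ℝ} (h : Neighboring D D') : Neighboring D' D := by
  unfold Neighboring mdist at *
  omega

/-- Neighboring datasets differ by the insertion of a single point. -/
lemma Neighboring.exists_cons {D D' : Multiset ℝ} (h : Neighboring D D') :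
    ∃ x, D = x ::ₘ D' ∨ D' = x ::ₘ D := by
  have key : ∀ E E' : Multiset ℝ, (E - E').card = 1 → (E' - E).card = 0 → ∃ x, E = x ::ₘ E' := by
    intro E E' h₁ h₀
    obtain ⟨x, hx⟩ := Multiset.card_eq_one.1 h₁
    have hle : E' ≤ E := tsub_eq_zero_iff_le.1 (Multiset.card_eq_zero.1 h₀)
    exact ⟨x, by rw [← tsub_add_cancel_of_le hle, hx, Multiset.singleton_add]⟩
  unfold Neighboring mdist at h
  rcases Nat.eq_zero_or_pos (D - D').card with h₀ | h₀
  · obtain ⟨x, hx⟩ := key D' D (by omega) h₀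
    exact ⟨x, Or.inr hx⟩
  · obtain ⟨x, hx⟩ := key D D' (by omega) (by omega)
    exact ⟨x, Or.inl hx⟩

lemma countLt_cons (x τ : ℝ) (D : Multiset ℝ) :
    countLt (x ::ₘ D) τ = countLt D τ + if x < τ then 1 else 0 := by
  unfold countLt
  split_ifs with h <;> simp [h]

lemma countLe_cons (x τ : ℝ) (D : Multiset ℝ) :
    countLe (x ::ₘ D) τ = countLe D τ + if x ≤ τ then 1 else 0 := by
  unfold countLe
  split_ifs with h <;> simp [h]

/-- Every rank of `τ` in `D'` is within one of a rank of `τ` in a neighbor `D`. -/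
lemma Neighboring.exists_mem_ranks {D D' : Multiset ℝ} (h : Neighboring D D') {τ : ℝ} {n : ℕ}
    (hn : n ∈ ranks τ D') : ∃ m ∈ ranks τ D, m ≤ n + 1 ∧ n ≤ m + 1 := by
  have hD := countLt_le_countLe D τ
  have hD' := countLt_le_countLe D' τ
  rw [mem_ranks_iff] at hn
  refine ⟨max (countLt D τ) (min n (countLe D τ)), mem_ranks_iff.2 ⟨by omega, by omega⟩, ?_⟩
  obtain ⟨x, rfl | rfl⟩ := h.exists_cons <;>
  · rw [countLt_cons, countLe_cons] at *
    split_ifs at * <;> omega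

lemma Neighboring.rankerror_le {D D' : Multiset ℝ} (h : Neighboring D D') (τ r : ℝ) :
    rankerror τ r D ≤ rankerror τ r D' + 1 := by
  refine sInf_image_le_sInf_image_add_one (fun _ _ => abs_nonneg _) (ranks_nonempty τ D') ?_
  intro n hn
  obtain ⟨m, hm, hmn, hnm⟩ := h.exists_mem_ranks hn
  refine ⟨m, hm, ?_⟩
  have hmn' : (m : ℝ) ≤ n + 1 := by exact_mod_cast hmn
  have hnm' : (n : ℝ) ≤ m + 1 := by exact_mod_cast hnm
  have hdist : |(n : ℝ) - m| ≤ 1 := abs_le.2 ⟨by linarith, by linarith⟩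
  linarith [abs_sub_le r n m]

lemma Neighboring.winLoss_le {D D' : Multiset ℝ} (h : Neighboring D D') {α : ℝ} (hα : 0 ≤ α)
    (r τ : ℝ) : winLoss α r D τ ≤ winLoss α r D' τ + 1 :=
  sInf_image_le_sInf_image_add_one (fun _ _ => rankerror_nonneg _ _ _)
    (Set.nonempty_Icc.2 (by linarith)) fun t ht => ⟨t, ht, h.rankerror_le t r⟩

/-- the windowed rank-error loss has sensitivity at most one with respect
to adding or removing a single point; in particular so does the rank error itself. -/
theorem winLoss_sensitivity (D D' : Multiset ℝ) (hne : Neighboring D D')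
    (r α : ℝ) (hα : 0 ≤ α) :
    (∀ τ : ℝ, |winLoss α r D τ - winLoss α r D' τ| ≤ 1) ∧
      (∀ τ' : ℝ, |rankerror τ' r D - rankerror τ' r D'| ≤ 1) := by
  refine ⟨fun τ => abs_le.2 ⟨?_, ?_⟩, fun τ' => abs_le.2 ⟨?_, ?_⟩⟩
  · linarith [hne.symm.winLoss_le hα r τ]
  · linarith [hne.winLoss_le hα r τ]
  · linarith [hne.symm.rankerror_le τ' r]
  · linarith [hne.rankerror_le τ' r]
end
end

section
/- Let X¹,…,Xⁿ be real numbers forming the dataset X^n of size n, let t be a positive integer with t ≤ n/2, and let k ≥ 2. Define the empirical k-th central moment M̂_k(X^n) = (1/n) Σ_{i=1}^n |X_i − μ(X^n)|^k. Then |μ(X^n \ L_t(X^n)) − μ(X^n \ U_t(X^n))| ≤ 4 · M̂_k(X^n)^{1/k} · (t/n)^{1 − 1/k}. -/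
open MeasureTheory Multiset

noncomputable section

theorem Multiset.sum_map_nonneg_of_nonneg {f : ℝ → ℝ} (hf : ∀ x, 0 ≤ f x) (S : Multiset ℝ) :
    0 ≤ (S.map f).sum :=
  Multiset.sum_nonneg fun y hy => by
    obtain ⟨x, -, rfl⟩ := Multiset.mem_map.mp hy
    exact hf x

theorem Multiset.rpow_sum_abs_le_card_mul_sum_rpow (S : Multiset ℝ) (c : ℝ) {k : ℝ} (hk : 1 ≤ k) :
    ((S.map fun x => |x - c|).sum) ^ k ≤
      (S.card : ℝ) ^ (k - 1) * (S.map fun x => |x - c| ^ k).sum := by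
  have key (f : ℝ → ℝ) : (S.map f).sum = ∑ i : S, f i := by
    rw [Finset.sum_eq_multiset_sum, Multiset.map_univ]
  have h := Real.rpow_sum_le_const_mul_sum_rpow (Finset.univ : Finset S)
    (fun i => (i : ℝ) - c) hk
  rw [Finset.card_univ, Multiset.card_coe] at h
  rw [key, key]
  exact h

/-- The deviation of the sum of a sub-dataset from `card • c` is controlled, by the power mean
inequality, by the `k`-th absolute moment of the full dataset about `c`. -/
theorem Multiset.abs_sum_sub_card_mul_le {S D : Multiset ℝ} (hS : S ≤ D) (c : ℝ) {k : ℝ}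
    (hk : 1 ≤ k) :
    |S.sum - S.card * c| ≤
      (S.card : ℝ) ^ (1 - 1 / k) * ((D.map fun x => |x - c| ^ k).sum) ^ (1 / k) := by
  have hk0 : 0 < k := by linarith
  have hsum : S.sum - S.card * c = (S.map fun x => x - c).sum := by
    rw [Multiset.sum_map_sub]; simp
  have hle : (S.map fun x => |x - c| ^ k).sum ≤ (D.map fun x => |x - c| ^ k).sum := by
    obtain ⟨T, rfl⟩ := Multiset.le_iff_exists_add.mp hS
    rw [Multiset.map_add, Multiset.sum_add]
    exact le_add_of_nonneg_right
      (Multiset.sum_map_nonneg_of_nonneg (fun x => by positivity) T)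
  have hnn : 0 ≤ (S.map fun x => |x - c|).sum :=
    Multiset.sum_map_nonneg_of_nonneg (fun x => by positivity) _
  have hpow : ((S.map fun x => |x - c|).sum) ^ k ≤
      (S.card : ℝ) ^ (k - 1) * (D.map fun x => |x - c| ^ k).sum :=
    (S.rpow_sum_abs_le_card_mul_sum_rpow c hk).trans (by gcongr)
  have hDnn : 0 ≤ (D.map fun x => |x - c| ^ k).sum :=
    Multiset.sum_map_nonneg_of_nonneg (fun x => by positivity) _
  calc |S.sum - S.card * c| ≤ (S.map fun x => |x - c|).sum := by
        rw [hsum]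
        simpa [Multiset.map_map] using Multiset.abs_sum_le_sum_abs (s := S.map fun x => x - c)
    _ = (((S.map fun x => |x - c|).sum) ^ k) ^ (1 / k) := by
        rw [← Real.rpow_mul hnn, mul_one_div_cancel hk0.ne', Real.rpow_one]
    _ ≤ ((S.card : ℝ) ^ (k - 1) * (D.map fun x => |x - c| ^ k).sum) ^ (1 / k) := by
        gcongr
    _ = _ := by
        rw [Real.mul_rpow (by positivity) hDnn, ← Real.rpow_mul (by positivity)]
        congr 2
        field_simp

theorem lowerM_le (m : ℕ) (D : Multiset ℝ) : lowerM m D ≤ D := by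
  conv_rhs => rw [← D.sort_eq (· ≤ ·)]
  exact (List.take_sublist _ _).subperm

theorem upperM_le (m : ℕ) (D : Multiset ℝ) : upperM m D ≤ D := by
  conv_rhs => rw [← D.sort_eq (· ≤ ·)]
  exact (List.drop_sublist _ _).subperm

theorem card_lowerM {m : ℕ} {D : Multiset ℝ} (h : m ≤ D.card) : (lowerM m D).card = m := by
  simp [lowerM, h]

theorem card_upperM {m : ℕ} {D : Multiset ℝ} (h : m ≤ D.card) : (upperM m D).card = m := by
  simp only [upperM, Multiset.coe_card, List.length_drop, Multiset.length_sort]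
  omega

theorem mmean_sub {S D : Multiset ℝ} (h : S ≤ D) :
    mmean (D - S) = (D.sum - S.sum) / ((D.card : ℝ) - S.card) := by
  obtain ⟨T, rfl⟩ := Multiset.le_iff_exists_add.mp h
  simp [mmean]

/-- the gap between the two trimmed means is controlled by the empirical
`k`-th central moment: `|μ(D ∖ L_t) − μ(D ∖ U_t)| ≤ 4 M̂_k(D)^{1/k} (t/n)^{1−1/k}`. -/
theorem trimmed_mean_gap_moment_bound (D : Multiset ℝ) (n : ℕ) (hn : n = D.card)
    (t : ℕ) (ht : 0 < t) (htn : (t : ℝ) ≤ (n : ℝ) / 2)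
    (k : ℝ) (hk : 2 ≤ k) :
    |mmean (D - lowerM t D) - mmean (D - upperM t D)| ≤
      4 * (((D.map (fun x => |x - mmean D| ^ k)).sum / (n : ℝ)) ^ ((1 : ℝ) / k)) *
        (((t : ℝ) / (n : ℝ)) ^ (1 - (1 : ℝ) / k)) := by
  have ht0 : (0 : ℝ) < t := by exact_mod_cast ht
  have hn0 : (0 : ℝ) < n := by linarith
  have htD : t ≤ D.card := by
    rw [← hn]; exact_mod_cast (by linarith : (t : ℝ) ≤ n)
  have hL := Multiset.abs_sum_sub_card_mul_le (lowerM_le t D) (mmean D) (by linarith : 1 ≤ k)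
  have hU := Multiset.abs_sum_sub_card_mul_le (upperM_le t D) (mmean D) (by linarith : 1 ≤ k)
  rw [card_lowerM htD] at hL
  rw [card_upperM htD] at hU
  rw [mmean_sub (lowerM_le t D), mmean_sub (upperM_le t D), card_lowerM htD, card_upperM htD,
    ← hn, ← sub_div, abs_div, abs_of_pos (by linarith : (0 : ℝ) < n - t)]
  have hM : 0 ≤ (D.map fun x => |x - mmean D| ^ k).sum :=
    Multiset.sum_map_nonneg_of_nonneg (fun x => by positivity) _
  set M := (D.map fun x => |x - mmean D| ^ k).sum
  set B := (t : ℝ) ^ (1 - 1 / k) * M ^ (1 / k)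
  have hB : 0 ≤ B := by positivity
  have hnum : |D.sum - (lowerM t D).sum - (D.sum - (upperM t D).sum)| ≤ 2 * B := by
    rw [abs_le] at *
    constructor <;> linarith [hL.1, hL.2, hU.1, hU.2]
  have hnn : (n : ℝ) ^ (1 / k) * (n : ℝ) ^ (1 - 1 / k) = n := by
    rw [← Real.rpow_add hn0, add_sub_cancel, Real.rpow_one]
  have hrhs : 4 * (M / n) ^ (1 / k) * ((t : ℝ) / n) ^ (1 - 1 / k) = 4 * B / n := by
    rw [Real.div_rpow hM hn0.le, Real.div_rpow ht0.le hn0.le]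
    conv_rhs => rw [← hnn]
    simp only [B]
    field_simp
  rw [hrhs, div_le_div_iff₀ (by linarith) hn0]
  calc _ ≤ 2 * B * n := by gcongr
    _ ≤ 4 * B * (n - t) := by nlinarith
end
end
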